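/- Uniqueness of reducts: Let ⟨X, s, ∃x⃗.φ⟩ be an existentially constrained term and p a position of s. Suppose ρ and ρ' are renamed variants of the same left-linear constrained rewrite rule with Var(ρ) ∩ Var(s,φ) = ∅ and Var(ρ') ∩ Var(s,φ) = ∅. If ⟨X, s, ∃x⃗.φ⟩ →^p_ρ ⟨Y, t, ∃y⃗.ψ⟩ and ⟨X, s, ∃x⃗.φ⟩ →^p_{ρ'} ⟨Y', t', ∃y⃗'.ψ'⟩ are most general rewrite steps at the same position p, then ⟨Y, t, ∃y⃗.ψ⟩ ∼ ⟨Y', t', ∃y⃗'.ψ'⟩. -/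

import Mathlib

namespace LCTRS

open scoped Classical

noncomputable section

/-- First-order terms over function symbols `F` and variables `V`. -/
inductive Term (F V : Type) : Type where
  | var : V → Term F V
  | app : F → List (Term F V) → Term F V

variable {F V D : Type}

/-- Occurrence of a variable in a term. -/
inductive Term.VarIn (x : V) : Term F V → Prop where
  | var : Term.VarIn x (Term.var x)
  | app {f : F} {ts : List (Term F V)} {t : Term F V} :
      t ∈ ts → Term.VarIn x t → Term.VarIn x (Term.app f ts)

/-- The set of variables occurring in a term. -/
def Term.vars (t : Term F V) : Set V := {x | Term.VarIn x t}

/-- Application of a substitution to a term. -/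
def Term.subst (t : Term F V) (σ : V → Term F V) : Term F V :=
  match t with
  | .var x => σ x
  | .app f ts => .app f (ts.attach.map (fun u => u.1.subst σ))
decreasing_by
  have := List.sizeOf_lt_of_mem u.2
  simp only [Term.app.sizeOf_spec] at *
  omega

/-- The domain of a substitution. -/
def substDom (σ : V → Term F V) : Set V := {x | σ x ≠ Term.var x}

/-- Positions in a term. -/
abbrev Pos := List Nat

/-- `SubtermAt s p u`: the subterm of `s` at position `p` exists and equals `u`. -/
inductive SubtermAt : Term F V → Pos → Term F V → Prop where
  | refl (t : Term F V) : SubtermAt t [] t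
  | app {f : F} {ts : List (Term F V)} {i : Nat} {t u : Term F V} {p : Pos} :
      ts[i]? = some t → SubtermAt t p u → SubtermAt (Term.app f ts) (i :: p) u

/-- `ReplaceAt s p u t`: replacing the subterm of `s` at position `p` by `u` yields `t`. -/
inductive ReplaceAt : Term F V → Pos → Term F V → Term F V → Prop where
  | here (t u : Term F V) : ReplaceAt t [] u u
  | app {f : F} {ts : List (Term F V)} {i : Nat} {p : Pos} {u t t' : Term F V} :
      ts[i]? = some t → ReplaceAt t p u t' →
      ReplaceAt (Term.app f ts) (i :: p) u (Term.app f (ts.set i t'))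

/-- Replacement at a list of pairwise parallel positions (performed sequentially). -/
inductive ReplaceList : Term F V → List Pos → List (Term F V) → Term F V → Prop where
  | nil (t : Term F V) : ReplaceList t [] [] t
  | cons {t t₁ t₂ : Term F V} {p : Pos} {ps : List Pos} {u : Term F V} {us : List (Term F V)} :
      ReplaceAt t p u t₁ → ReplaceList t₁ ps us t₂ → ReplaceList t (p :: ps) (u :: us) t₂

/-- A term is linear if each variable occurs at most once in it. -/
def Term.Linear (t : Term F V) : Prop :=
  ∀ (x : V) (p q : Pos), SubtermAt t p (Term.var x) → SubtermAt t q (Term.var x) → p = q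

/-- A term is `X`-linear if each variable of `X` occurs at most once in it. -/
def Term.LinearOn (t : Term F V) (X : Set V) : Prop :=
  ∀ x ∈ X, ∀ (p q : Pos), SubtermAt t p (Term.var x) → SubtermAt t q (Term.var x) → p = q

/-- A model over the (theory part of the) signature: an interpretation of the function
symbols over a domain `D`, a designated truth value, a set `Val` of value constants such
that every domain element is denoted by some value, and designated conjunction, equality
and truth symbols interpreted as expected. -/
structure Model (F V D : Type) where
  interp : F → List D → D
  tval : D
  Val : Set F
  andSym : F
  eqSym : F
  trueSym : F
  val_const : ∀ v ∈ Val, ∀ ds : List D, interp v ds = interp v []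
  val_surj : ∀ d : D, ∃ v ∈ Val, interp v [] = d
  and_spec : ∀ a b : D, (interp andSym [a, b] = tval ↔ (a = tval ∧ b = tval))
  eq_spec : ∀ a b : D, (interp eqSym [a, b] = tval ↔ a = b)
  true_spec : interp trueSym [] = tval

/-- Evaluation of a term in a model under a valuation. -/
def Model.eval (M : Model F V D) (ξ : V → D) (t : Term F V) : D :=
  match t with
  | .var x => ξ x
  | .app f ts => M.interp f (ts.attach.map (fun u => M.eval ξ u.1))
decreasing_by
  have := List.sizeOf_lt_of_mem u.2
  simp only [Term.app.sizeOf_spec] at *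
  omega

/-- A constraint holds in `M` under the valuation `ξ`. -/
def Model.holds (M : Model F V D) (ξ : V → D) (φ : Term F V) : Prop := M.eval ξ φ = M.tval

/-- `⊨_M φ`: the constraint `φ` holds under every valuation. -/
def Model.validC (M : Model F V D) (φ : Term F V) : Prop := ∀ ξ : V → D, M.holds ξ φ

/-- `t` is a value (a constant from `Val`). -/
def Model.IsValueTerm (M : Model F V D) (t : Term F V) : Prop := ∃ v ∈ M.Val, t = Term.app v []

/-- The root symbol of `t` is a value symbol. -/
def Model.IsValueSym (M : Model F V D) (t : Term F V) : Prop :=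
  ∃ v ∈ M.Val, ∃ ts : List (Term F V), t = Term.app v ts

/-- No value occurs in `t`. -/
def Term.ValueFree (t : Term F V) (M : Model F V D) : Prop :=
  ∀ (p : Pos) (u : Term F V), SubtermAt t p u → ¬ M.IsValueSym u

/-- The conjunction `φ ∧ ψ` as a constraint. -/
def Model.conj (M : Model F V D) (φ ψ : Term F V) : Term F V := Term.app M.andSym [φ, ψ]

/-- The equation `s = t` as a constraint. -/
def Model.eqc (M : Model F V D) (s t : Term F V) : Term F V := Term.app M.eqSym [s, t]

/-- The constraint `true`. -/
def Model.trueC (M : Model F V D) : Term F V := Term.app M.trueSym []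

/-- `φ ∧ ψ₁ ∧ ⋯ ∧ ψₙ`. -/
def Model.conjFrom (M : Model F V D) (φ : Term F V) (l : List (Term F V)) : Term F V :=
  l.foldl M.conj φ

/-- `ψ₁ ∧ ⋯ ∧ ψₙ`. -/
def Model.bigConj (M : Model F V D) (l : List (Term F V)) : Term F V :=
  l.foldl M.conj M.trueC

/-- An existential constraint `⟨∃x⃗. φ⟩`: a set of (bound) variables together with a
constraint. -/
structure EC (F V : Type) where
  bvars : Set V
  constr : Term F V

/-- Well-formedness of an existential constraint: `{x⃗} ⊆ Var(φ)`. -/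
def EC.WF (c : EC F V) : Prop := c.bvars ⊆ c.constr.vars

/-- Free variables of an existential constraint. -/
def EC.fvars (c : EC F V) : Set V := c.constr.vars \ c.bvars

/-- `⟨∃x⃗. φ⟩` holds under valuation `ξ`: `φκ` holds under `ξ` for some substitution `κ`
mapping `x⃗` into `Val` (and the identity elsewhere). -/
def EC.holdsUnder (c : EC F V) (M : Model F V D) (ξ : V → D) : Prop :=
  ∃ κ : V → Term F V, (∀ x ∈ c.bvars, M.IsValueTerm (κ x)) ∧
    (∀ x ∉ c.bvars, κ x = Term.var x) ∧ M.holds ξ (c.constr.subst κ)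

/-- `⊨_M ⟨∃x⃗. φ⟩`. -/
def EC.validM (c : EC F V) (M : Model F V D) : Prop := ∀ ξ : V → D, c.holdsUnder M ξ

/-- Satisfiability of an existential constraint. -/
def EC.satisfiable (c : EC F V) (M : Model F V D) : Prop := ∃ ξ : V → D, c.holdsUnder M ξ

/-- Application of a substitution to an existential constraint acts on the free
variables only. -/
def EC.subst (c : EC F V) (σ : V → Term F V) : EC F V :=
  ⟨c.bvars, c.constr.subst (fun x => if x ∈ c.bvars then Term.var x else σ x)⟩

/-- `⊨_M ⟨∃x⃗.φ⟩ ⇔ ⟨∃y⃗.ψ⟩`. -/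
def ECIffM (M : Model F V D) (c c' : EC F V) : Prop :=
  ∀ ξ : V → D, c.holdsUnder M ξ ↔ c'.holdsUnder M ξ

/-- `σ ⊨_M ⟨∃x⃗.φ⟩`: `σ` maps the free variables into values and `(⟨∃x⃗.φ⟩)σ` is valid. -/
def SubstRespectsEC (M : Model F V D) (σ : V → Term F V) (c : EC F V) : Prop :=
  (∀ x ∈ c.fvars, M.IsValueTerm (σ x)) ∧ (c.subst σ).validM M

/-- `σ` respects the plain constraint `φ`. -/
def SubstRespects (M : Model F V D) (σ : V → Term F V) (φ : Term F V) : Prop :=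
  (∀ x ∈ φ.vars, M.IsValueTerm (σ x)) ∧ M.validC (φ.subst σ)

/-- An existentially constrained term `⟨X, s, ∃x⃗.φ⟩`. -/
structure ECTerm (F V : Type) where
  lvars : Set V
  term : Term F V
  ec : EC F V

/-- Well-formedness: `{x⃗} ⊆ Var(φ)`, `FVar(⟨∃x⃗.φ⟩) ⊆ X ⊆ Var(s)` and `{x⃗} ∩ Var(s) = ∅`. -/
def ECTerm.WF (T : ECTerm F V) : Prop :=
  T.ec.WF ∧ T.ec.fvars ⊆ T.lvars ∧ T.lvars ⊆ T.term.vars ∧ ∀ x ∈ T.ec.bvars, x ∉ T.term.vars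

/-- Satisfiability of an existentially constrained term. -/
def ECTerm.satisfiable (T : ECTerm F V) (M : Model F V D) : Prop := T.ec.satisfiable M

/-- `T` is subsumed by `T'`. -/
def SubsumedBy (M : Model F V D) (T T' : ECTerm F V) : Prop :=
  ∀ σ : V → Term F V, (∀ x ∈ T.lvars, M.IsValueTerm (σ x)) → SubstRespectsEC M σ T.ec →
    ∃ γ : V → Term F V, (∀ y ∈ T'.lvars, M.IsValueTerm (γ y)) ∧ SubstRespectsEC M γ T'.ec ∧
      T.term.subst σ = T'.term.subst γ

/-- Equivalence of existentially constrained terms. -/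
def ECEquiv (M : Model F V D) (T T' : ECTerm F V) : Prop :=
  SubsumedBy M T T' ∧ SubsumedBy M T' T

/-- An existentially constrained term is pattern-general if its term is linear in its
logical variables and contains no value. -/
def ECTerm.PatternGeneral (T : ECTerm F V) (M : Model F V D) : Prop :=
  T.term.LinearOn T.lvars ∧ T.term.ValueFree M

/-- A constrained rewrite rule `Π Z. ℓ → r [π]`. -/
structure Rule (F V : Type) where
  Z : Set V
  lhs : Term F V
  rhs : Term F V
  constr : Term F V

/-- `Var(ρ)`. -/
def Rule.vars (ρ : Rule F V) : Set V := ρ.lhs.vars ∪ ρ.rhs.vars ∪ ρ.constr.vars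

/-- `ExVar(ρ) = Var(r) \ Var(ℓ)`. -/
def Rule.exVars (ρ : Rule F V) : Set V := ρ.rhs.vars \ ρ.lhs.vars

/-- Well-formedness of a rule: `(Var(r) \ Var(ℓ)) ∪ Var(π) ⊆ Z ⊆ Var(ℓ,r,π)`. -/
def Rule.WF (ρ : Rule F V) : Prop :=
  (ρ.rhs.vars \ ρ.lhs.vars) ∪ ρ.constr.vars ⊆ ρ.Z ∧ ρ.Z ⊆ ρ.vars

/-- Left-linearity. -/
def Rule.LeftLinear (ρ : Rule F V) : Prop := ρ.lhs.Linear

/-- A rule is left-value-free if it is left-linear and no value occurs in its lhs. -/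
def Rule.LeftValueFree (ρ : Rule F V) (M : Model F V D) : Prop :=
  ρ.LeftLinear ∧ ρ.lhs.ValueFree M

/-- `ρ'` is a renamed variant of `ρ`. -/
def Rule.IsVariantOf (ρ' ρ : Rule F V) : Prop :=
  ∃ δ : V → V, Function.Bijective δ ∧
    ρ'.Z = δ '' ρ.Z ∧ ρ'.lhs = ρ.lhs.subst (fun x => Term.var (δ x)) ∧
    ρ'.rhs = ρ.rhs.subst (fun x => Term.var (δ x)) ∧
    ρ'.constr = ρ.constr.subst (fun x => Term.var (δ x))

/-- `⟨X,s,∃x⃗.φ⟩` has a `ρ`-redex at position `p` using substitution `γ`. -/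
structure RedexAt (M : Model F V D) (ρ : Rule F V) (T : ECTerm F V)
    (p : Pos) (γ : V → Term F V) : Prop where
  dom : substDom γ = ρ.lhs.vars
  matchAt : SubtermAt T.term p (ρ.lhs.subst γ)
  lvar : ∀ x ∈ ρ.lhs.vars ∩ ρ.Z, M.IsValueTerm (γ x) ∨ ∃ y ∈ T.lvars, γ x = Term.var y
  implied : ∀ ξ : V → D, T.ec.holdsUnder M ξ →
    EC.holdsUnder ⟨ρ.constr.vars \ ρ.lhs.vars, ρ.constr.subst γ⟩ M ξ

/-- A most general rewrite step at position `p` using substitution `γ`. -/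
structure MGStepData (M : Model F V D) (ρ : Rule F V) (T T' : ECTerm F V)
    (p : Pos) (γ : V → Term F V) : Prop where
  redex : RedexAt M ρ T p γ
  target : ReplaceAt T.term p (ρ.rhs.subst γ) T'.term
  cstr : T'.ec.constr = M.conj T.ec.constr (ρ.constr.subst γ)
  bnd : T'.ec.bvars = T'.ec.constr.vars \ T'.term.vars
  lv : T'.lvars = ρ.exVars ∪ (T.lvars ∩ T'.term.vars)

/-- A most general rewrite step at position `p`. -/
def MGStepAt (M : Model F V D) (ρ : Rule F V) (p : Pos) (T T' : ECTerm F V) : Prop :=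
  ∃ γ : V → Term F V, MGStepData M ρ T T' p γ

/-- A most general rewrite step. -/
def MGStep (M : Model F V D) (ρ : Rule F V) (T T' : ECTerm F V) : Prop :=
  ∃ (p : Pos) (γ : V → Term F V), MGStepData M ρ T T' p γ

/-- A non-quantified constrained term `⟨X, s, φ⟩`. -/
structure NQTerm (F V : Type) where
  lvars : Set V
  term : Term F V
  constr : Term F V

/-- Well-formedness: `Var(φ) ⊆ X ⊆ Var(φ, s)`. -/
def NQTerm.WF (T : NQTerm F V) : Prop :=
  T.constr.vars ⊆ T.lvars ∧ T.lvars ⊆ T.constr.vars ∪ T.term.vars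

/-- Satisfiability of a non-quantified constrained term. -/
def NQTerm.satisfiable (T : NQTerm F V) (M : Model F V D) : Prop :=
  ∃ ξ : V → D, M.holds ξ T.constr

/-- Subsumption of non-quantified constrained terms. -/
def NQSubsumedBy (M : Model F V D) (T T' : NQTerm F V) : Prop :=
  ∀ σ : V → Term F V, (∀ x ∈ T.lvars, M.IsValueTerm (σ x)) → SubstRespects M σ T.constr →
    ∃ γ : V → Term F V, (∀ y ∈ T'.lvars, M.IsValueTerm (γ y)) ∧ SubstRespects M γ T'.constr ∧
      T.term.subst σ = T'.term.subst γ

/-- Equivalence of non-quantified constrained terms. -/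
def NQEquiv (M : Model F V D) (T T' : NQTerm F V) : Prop :=
  NQSubsumedBy M T T' ∧ NQSubsumedBy M T' T

/-- A rewrite step on non-quantified constrained terms at position `p` using `σ`. -/
structure NQStepData (M : Model F V D) (ρ : Rule F V) (T T' : NQTerm F V)
    (p : Pos) (σ : V → Term F V) : Prop where
  fresh : Disjoint ρ.vars (T.lvars ∪ T.term.vars ∪ T.constr.vars)
  funpos : ∃ (f : F) (ts : List (Term F V)), SubtermAt T.term p (Term.app f ts)
  dom : substDom σ = ρ.vars
  matchAt : SubtermAt T.term p (ρ.lhs.subst σ)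
  zval : ∀ x ∈ ρ.Z, M.IsValueTerm (σ x) ∨ ∃ y ∈ T.lvars, σ x = Term.var y
  implied : ∀ ξ : V → D, M.holds ξ T.constr → M.holds ξ (ρ.constr.subst σ)
  target : ReplaceAt T.term p (ρ.rhs.subst σ) T'.term
  cstr : T'.constr = T.constr
  lv : T'.lvars = T.lvars ∩ (T'.term.vars ∪ T.constr.vars)

/-- A rewrite step on non-quantified constrained terms. -/
def NQStep (M : Model F V D) (ρ : Rule F V) (T T' : NQTerm F V) : Prop :=
  ∃ (p : Pos) (σ : V → Term F V), NQStepData M ρ T T' p σ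

/-- The existential removing translation `rmv`. -/
def rmv (T : ECTerm F V) : NQTerm F V := ⟨T.lvars ∪ T.ec.bvars, T.term, T.ec.constr⟩

/-- The existential extension translation `ext`. -/
def ext (T : NQTerm F V) : ECTerm F V :=
  ⟨T.lvars \ (T.constr.vars \ T.term.vars), T.term, ⟨T.constr.vars \ T.term.vars, T.constr⟩⟩

/-- Positions of `s` whose symbol is a variable of `X` or a value. -/
def PosXVal (M : Model F V D) (X : Set V) (s : Term F V) : Set Pos :=
  {p | ∃ u : Term F V, SubtermAt s p u ∧ ((∃ x ∈ X, u = Term.var x) ∨ M.IsValueSym u)}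

/-- `s'` is the bullet translation `s^{•X}` of `s`, obtained by replacing the subterms at
the positions `ps` (which enumerate `Pos_{X∪Val}(s)`) by the pairwise distinct fresh
variables `xs`. -/
structure BulletData (M : Model F V D) (X avoid : Set V) (s : Term F V)
    (ps : List Pos) (xs : List V) (s' : Term F V) : Prop where
  nodup_ps : ps.Nodup
  cover : ∀ p : Pos, p ∈ ps ↔ p ∈ PosXVal M X s
  nodup_xs : xs.Nodup
  len : xs.length = ps.length
  fresh : ∀ x ∈ xs, x ∉ avoid
  repl : ReplaceList s ps (xs.map Term.var) s'

/-- `T'` is the pattern-general translation `PG(T)` of `T` (with fresh variables chosen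
outside `avoid`). -/
def IsPG (M : Model F V D) (avoid : Set V) (T T' : ECTerm F V) : Prop :=
  ∃ (ps : List Pos) (xs : List V) (us : List (Term F V)),
    BulletData M T.lvars avoid T.term ps xs T'.term ∧
    List.Forall₂ (fun p u => SubtermAt T.term p u) ps us ∧
    T'.lvars = {x | x ∈ xs} ∧
    T'.ec.bvars = T.ec.bvars ∪ T.lvars ∧
    T'.ec.constr = M.conjFrom T.ec.constr (List.zipWith M.eqc us (xs.map Term.var))

/-- `ρh` is the left-value-free transformation `lvf(ρ)` of `ρ`. -/
def IsLVF (M : Model F V D) (ρ ρh : Rule F V) : Prop :=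
  ∃ (ps : List Pos) (xs : List V) (vs : List (Term F V)),
    ps.Nodup ∧ xs.Nodup ∧ xs.length = ps.length ∧
    (∀ p : Pos, p ∈ ps ↔ p ∈ PosXVal M (∅ : Set V) ρ.lhs) ∧
    List.Forall₂ (fun p v => SubtermAt ρ.lhs p v ∧ M.IsValueTerm v) ps vs ∧
    (∀ x ∈ xs, x ∉ ρ.vars) ∧
    ρh.Z = ρ.Z ∪ {x | x ∈ xs} ∧
    ReplaceList ρ.lhs ps (xs.map Term.var) ρh.lhs ∧
    ρh.rhs = ρ.rhs ∧
    ρh.constr = M.conjFrom ρ.constr (List.zipWith M.eqc (xs.map Term.var) vs)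

/-- A most general rewrite step with a fresh variant of some rule of the LCTRS `R`. -/
def StepR (M : Model F V D) (R : Set (Rule F V)) (T T' : ECTerm F V) : Prop :=
  ∃ ρ ∈ R, ∃ ρ' : Rule F V, ρ'.IsVariantOf ρ ∧
    Disjoint ρ'.vars (T.term.vars ∪ T.ec.constr.vars) ∧ MGStep M ρ' T T'

/-- One `∼ · →_R` step (on well-formed, satisfiable existentially constrained terms). -/
def SimStep (M : Model F V D) (R : Set (Rule F V)) (T T' : ECTerm F V) : Prop :=
  ∃ U : ECTerm F V, U.WF ∧ U.satisfiable M ∧ ECEquiv M T U ∧ StepR M R U T'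

/-- `n`-fold composition of a relation. -/
def RelPow {α : Type _} (r : α → α → Prop) : ℕ → α → α → Prop
  | 0 => fun a b => a = b
  | n + 1 => fun a c => ∃ b, r a b ∧ RelPow r n b c

@[simp] theorem Term.subst_var (x : V) (σ : V → Term F V) :
    (Term.var x).subst σ = σ x := by
  rw [Term.subst]

@[simp] theorem Term.subst_app (f : F) (ts : List (Term F V)) (σ : V → Term F V) :
    (Term.app f ts).subst σ = Term.app f (ts.map fun u => u.subst σ) := by
  rw [Term.subst, List.attach_map_val (f := fun u : Term F V => u.subst σ)]

@[simp] theorem Term.mem_vars_var {x y : V} : x ∈ (Term.var y : Term F V).vars ↔ x = y :=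
  ⟨fun h => by cases h; rfl, fun h => h ▸ Term.VarIn.var⟩

@[simp] theorem Term.mem_vars_app {x : V} {f : F} {ts : List (Term F V)} :
    x ∈ (Term.app f ts).vars ↔ ∃ t ∈ ts, x ∈ t.vars :=
  ⟨fun h => by cases h with | app h₁ h₂ => exact ⟨_, h₁, h₂⟩,
    fun ⟨_, h₁, h₂⟩ => Term.VarIn.app h₁ h₂⟩

/-- Induction on terms, with the induction hypothesis for all members of the argument list. -/
theorem Term.induction_on_args {P : Term F V → Prop} (t : Term F V)
    (var : ∀ x, P (Term.var x)) (app : ∀ f ts, (∀ t ∈ ts, P t) → P (Term.app f ts)) : P t :=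
  match t with
  | .var x => var x
  | .app f ts => app f ts fun u _ => Term.induction_on_args u var app

theorem Term.subst_eq_subst_iff {t : Term F V} {σ τ : V → Term F V} :
    t.subst σ = t.subst τ ↔ ∀ x ∈ t.vars, σ x = τ x := by
  induction t using Term.induction_on_args with
  | var x => simp
  | app f ts ih =>
    simp only [Term.subst_app, Term.app.injEq, true_and, List.map_inj_left, Term.mem_vars_app]
    constructor
    · rintro h x ⟨t, ht, hx⟩
      exact (ih t ht).1 (h t ht) x hx
    · intro h t ht
      exact (ih t ht).2 fun x hx => h x ⟨t, ht, hx⟩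

theorem Term.subst_var_eq_self (t : Term F V) : t.subst Term.var = t := by
  induction t using Term.induction_on_args with
  | var x => simp
  | app f ts ih =>
    rw [Term.subst_app, List.map_congr_left ih, List.map_id']

theorem Term.subst_eq_self {t : Term F V} {σ : V → Term F V}
    (h : ∀ x ∈ t.vars, σ x = Term.var x) : t.subst σ = t :=
  (Term.subst_eq_subst_iff.2 h).trans t.subst_var_eq_self

theorem Term.subst_subst (t : Term F V) (σ τ : V → Term F V) :
    (t.subst σ).subst τ = t.subst fun x => (σ x).subst τ := by
  induction t using Term.induction_on_args with
  | var x => simp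
  | app f ts ih => simpa using ih

theorem Term.mem_vars_subst {t : Term F V} {σ : V → Term F V} {x : V} :
    x ∈ (t.subst σ).vars ↔ ∃ y ∈ t.vars, x ∈ (σ y).vars := by
  induction t using Term.induction_on_args with
  | var y => simp
  | app f ts ih =>
    simp only [Term.subst_app, Term.mem_vars_app, List.mem_map]
    constructor
    · rintro ⟨_, ⟨t, ht, rfl⟩, hx⟩
      obtain ⟨y, hy, hxy⟩ := (ih t ht).1 hx
      exact ⟨y, ⟨t, ht, hy⟩, hxy⟩
    · rintro ⟨y, ⟨t, ht, hy⟩, hxy⟩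
      exact ⟨_, ⟨t, ht, rfl⟩, (ih t ht).2 ⟨y, hy, hxy⟩⟩

/-- The variables of a renamed term are the renamed variables. -/
theorem Term.vars_rename (t : Term F V) (δ : V → V) :
    (t.subst fun x => Term.var (δ x)).vars = δ '' t.vars := by
  ext x
  simp [Term.mem_vars_subst, eq_comm]

theorem SubtermAt.unique {s u u' : Term F V} {p : Pos}
    (h : SubtermAt s p u) (h' : SubtermAt s p u') : u = u' := by
  induction h with
  | refl => cases h'; rfl
  | app hi _ ih =>
    cases h' with
    | app hi' h' =>
      obtain rfl := Option.some.inj (hi.symm.trans hi')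
      exact ih h'

theorem SubtermAt.vars_subset {s u : Term F V} {p : Pos} (h : SubtermAt s p u) :
    u.vars ⊆ s.vars := by
  induction h with
  | refl => exact subset_rfl
  | app hi _ ih => exact fun x hx => Term.VarIn.app (List.mem_of_getElem? hi) (ih hx)

theorem ReplaceAt.unique {s u t t' : Term F V} {p : Pos}
    (h : ReplaceAt s p u t) (h' : ReplaceAt s p u t') : t = t' := by
  induction h generalizing t' with
  | here => cases h'; rfl
  | app hi _ ih =>
    cases h' with
    | app hi' h' =>
      obtain rfl := Option.some.inj (hi.symm.trans hi')
      rw [ih h']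

theorem ReplaceAt.subst {s u t : Term F V} {p : Pos} (h : ReplaceAt s p u t)
    (σ : V → Term F V) : ReplaceAt (s.subst σ) p (u.subst σ) (t.subst σ) := by
  induction h with
  | here => exact .here _ _
  | app hi _ ih =>
    simp only [Term.subst_app, List.map_set]
    exact .app (by simp [hi]) ih

theorem ReplaceAt.vars_subset {s u t : Term F V} {p : Pos} (h : ReplaceAt s p u t) :
    t.vars ⊆ s.vars ∪ u.vars := by
  induction h with
  | here => exact Set.subset_union_right
  | @app f ts i p u v v' hi _ ih =>
    intro x hx
    obtain ⟨w, hw, hxw⟩ := Term.mem_vars_app.1 hx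
    rcases List.mem_or_eq_of_mem_set hw with hw | rfl
    · exact Or.inl (Term.mem_vars_app.2 ⟨w, hw, hxw⟩)
    · exact (ih hxw).imp_left fun h => Term.mem_vars_app.2 ⟨v, List.mem_of_getElem? hi, h⟩

theorem Model.IsValueTerm.subst_eq {M : Model F V D} {t : Term F V} (h : M.IsValueTerm t)
    (σ : V → Term F V) : t.subst σ = t := by
  obtain ⟨v, -, rfl⟩ := h
  simp

theorem Model.conj_subst (M : Model F V D) (φ ψ : Term F V) (σ : V → Term F V) :
    (M.conj φ ψ).subst σ = M.conj (φ.subst σ) (ψ.subst σ) := by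
  simp [Model.conj]

theorem Model.vars_conj (M : Model F V D) (φ ψ : Term F V) :
    (M.conj φ ψ).vars = φ.vars ∪ ψ.vars := by
  ext x
  simp [Model.conj]

theorem Rule.vars_rename {ρ ρ' : Rule F V} {δ : V → V}
    (hl : ρ'.lhs = ρ.lhs.subst fun x => Term.var (δ x))
    (hr : ρ'.rhs = ρ.rhs.subst fun x => Term.var (δ x))
    (hc : ρ'.constr = ρ.constr.subst fun x => Term.var (δ x)) : ρ'.vars = δ '' ρ.vars := by
  simp only [Rule.vars, hl, hr, hc, Term.vars_rename, Set.image_union]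

theorem Rule.IsVariantOf.symm {ρ ρ' : Rule F V} (h : ρ'.IsVariantOf ρ) : ρ.IsVariantOf ρ' := by
  obtain ⟨δ, hδ, hZ, hl, hr, hc⟩ := h
  let e := Equiv.ofBijective δ hδ
  have he : ∀ x, e.symm (δ x) = x := e.symm_apply_apply
  refine ⟨e.symm, e.symm.bijective, ?_, ?_, ?_, ?_⟩
  · simp [hZ, Set.image_image, he]
  all_goals simp [hl, hr, hc, Term.subst_subst, he, Term.subst_eq_self]

theorem Rule.IsVariantOf.trans {ρ ρ' ρ'' : Rule F V} (h' : ρ''.IsVariantOf ρ')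
    (h : ρ'.IsVariantOf ρ) : ρ''.IsVariantOf ρ := by
  obtain ⟨δ, hδ, hZ, hl, hr, hc⟩ := h
  obtain ⟨δ', hδ', hZ', hl', hr', hc'⟩ := h'
  refine ⟨δ' ∘ δ, hδ'.comp hδ, ?_, ?_, ?_, ?_⟩
  · simp [hZ, hZ', Set.image_image]
  · simp [hl, hl', Term.subst_subst]
  · simp [hr, hr', Term.subst_subst]
  · simp [hc, hc', Term.subst_subst]

/-- A constrained term whose bound variables are exactly the constraint variables not occurring
in its term is subsumed by each of its injective renamings. -/
theorem SubsumedBy.of_rename (M : Model F V D) {T T' : ECTerm F V} {S : Set V} {η : V → V}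
    (hη : Set.InjOn η S) (hterm : T.term.vars ⊆ S) (hconstr : T.ec.constr.vars ⊆ S)
    (hlvars : T.lvars ⊆ S)
    (hterm' : T'.term = T.term.subst fun x => Term.var (η x))
    (hconstr' : T'.ec.constr = T.ec.constr.subst fun x => Term.var (η x))
    (hlvars' : T'.lvars ⊆ η '' T.lvars)
    (hb : T.ec.bvars = T.ec.constr.vars \ T.term.vars)
    (hb' : T'.ec.bvars = T'.ec.constr.vars \ T'.term.vars) : SubsumedBy M T T' := by
  rintro σ hσ ⟨hfv, hvalid⟩
  obtain ⟨θ, hinv⟩ : ∃ θ : V → V, ∀ x ∈ S, θ (η x) = x := by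
    cases isEmpty_or_nonempty V
    · exact ⟨id, fun x => isEmptyElim x⟩
    · exact ⟨Function.invFunOn η S, fun x hx => hη.leftInvOn_invFunOn hx⟩
  have hmem_term : ∀ x ∈ S, η x ∈ T'.term.vars ↔ x ∈ T.term.vars := fun x hx => by
    rw [hterm', Term.vars_rename, hη.mem_image_iff hterm hx]
  have hmem_constr : ∀ x ∈ S, η x ∈ T'.ec.constr.vars ↔ x ∈ T.ec.constr.vars := fun x hx => by
    rw [hconstr', Term.vars_rename, hη.mem_image_iff hconstr hx]
  have hmem_b : ∀ x ∈ S, η x ∈ T'.ec.bvars ↔ x ∈ T.ec.bvars := fun x hx => by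
    rw [hb, hb', Set.mem_sdiff, Set.mem_sdiff, hmem_term x hx, hmem_constr x hx]
  have hsurj : ∀ y ∈ T'.ec.constr.vars, ∃ x ∈ T.ec.constr.vars, η x = y := fun y hy => by
    rwa [hconstr', Term.vars_rename] at hy
  refine ⟨fun y => σ (θ y), ?_, ⟨?_, fun ξ => ?_⟩, ?_⟩
  · intro y hy
    obtain ⟨x, hx, rfl⟩ := hlvars' hy
    simpa only [hinv x (hlvars hx)] using hσ x hx
  · rintro y ⟨hy, hyb⟩
    obtain ⟨x, hx, rfl⟩ := hsurj y hy
    rw [hmem_b x (hconstr hx)] at hyb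
    simpa only [hinv x (hconstr hx)] using hfv x ⟨hx, hyb⟩
  · obtain ⟨κ, hκb, hκ, hholds⟩ := hvalid ξ
    refine ⟨fun y => if y ∈ T'.ec.bvars then κ (θ y) else Term.var y, ?_, ?_, ?_⟩
    · intro y (hy : y ∈ T'.ec.bvars)
      obtain ⟨x, hx, rfl⟩ := hsurj y (hb' ▸ hy).1
      simp only [if_pos hy, hinv x (hconstr hx)]
      exact hκb x ((hmem_b x (hconstr hx)).1 hy)
    · intro y hy
      exact if_neg hy
    · convert hholds using 1
      simp only [EC.subst, hconstr', Term.subst_subst, Term.subst_var]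
      refine Term.subst_eq_subst_iff.2 fun x hx => ?_
      have hxS := hconstr hx
      by_cases hxb : x ∈ T.ec.bvars
      · simp [hmem_b x hxS, hxb, hinv x hxS]
      · simp only [hmem_b x hxS, hxb, if_false, hinv x hxS]
        rw [(hfv x ⟨hx, hxb⟩).subst_eq, (hfv x ⟨hx, hxb⟩).subst_eq]
  · rw [hterm', Term.subst_subst]
    refine Term.subst_eq_subst_iff.2 fun x hx => ?_
    simp [hinv x (hterm hx)]

/-- The reduct of a most general rewrite step is subsumed by the reduct obtained at the same
position with any fresh variant of the rule. -/
theorem SubsumedBy.of_variant_steps (M : Model F V D) {T T₁ T₂ : ECTerm F V} {ρ ρ' : Rule F V}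
    {p : Pos} (hT : T.WF) (hρ : ρ'.IsVariantOf ρ)
    (hd : Disjoint ρ.vars (T.term.vars ∪ T.ec.constr.vars))
    (hd' : Disjoint ρ'.vars (T.term.vars ∪ T.ec.constr.vars))
    (h1 : MGStepAt M ρ p T T₁) (h2 : MGStepAt M ρ' p T T₂) : SubsumedBy M T₁ T₂ := by
  obtain ⟨γ, s⟩ := h1
  obtain ⟨γ', s'⟩ := h2
  obtain ⟨τ, hτ, -, hl, hr, hc⟩ := hρ
  have hvars : ρ'.vars = τ '' ρ.vars := Rule.vars_rename hl hr hc
  have hlvars : T.lvars ⊆ T.term.vars := hT.2.2.1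
  have hlτ : ∀ x, τ x ∈ ρ'.lhs.vars ↔ x ∈ ρ.lhs.vars := fun x => by
    rw [hl, Term.vars_rename, hτ.1.mem_set_image]
  have hγ : ∀ x ∉ ρ.lhs.vars, γ x = Term.var x := fun x hx => by
    rw [← s.redex.dom] at hx
    exact not_not.1 hx
  have hγ' : ∀ x ∉ ρ'.lhs.vars, γ' x = Term.var x := fun x hx => by
    rw [← s'.redex.dom] at hx
    exact not_not.1 hx
  have hmatch : ∀ x ∈ ρ.lhs.vars, γ x = γ' (τ x) := by
    have h := s.redex.matchAt.unique s'.redex.matchAt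
    rw [hl, Term.subst_subst] at h
    simpa using Term.subst_eq_subst_iff.1 h
  set A := T.term.vars ∪ T.ec.constr.vars
  have hγA : ∀ x ∈ ρ.lhs.vars, (γ x).vars ⊆ A := fun x hx y hy =>
    Or.inl (s.redex.matchAt.vars_subset (Term.mem_vars_subst.2 ⟨x, hx, hy⟩))
  let B := ρ.vars \ ρ.lhs.vars
  let η : V → V := fun x => if x ∈ B then τ x else x
  have hηB : ∀ x ∈ B, η x = τ x := fun x hx => if_pos hx
  have hηA : ∀ x ∈ A, η x = x := fun x hx =>
    if_neg fun h => Set.disjoint_left.1 hd h.1 hx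
  have hτA : ∀ x ∈ B, τ x ∉ A := fun x hx =>
    Set.disjoint_left.1 hd' (hvars ▸ Set.mem_image_of_mem τ hx.1)
  have hηinj : Set.InjOn η (A ∪ B) := by
    rintro x (hx | hx) y (hy | hy) hxy
    · rwa [hηA x hx, hηA y hy] at hxy
    · rw [hηA x hx, hηB y hy] at hxy
      exact absurd (hxy ▸ hx) (hτA y hy)
    · rw [hηB x hx, hηA y hy] at hxy
      exact absurd (hxy ▸ hy) (hτA x hx)
    · rw [hηB x hx, hηB y hy] at hxy
      exact hτ.1 hxy
  have hγη : ∀ x ∈ ρ.vars, (γ x).subst (fun y => Term.var (η y)) = γ' (τ x) := by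
    intro x hx
    by_cases hxl : x ∈ ρ.lhs.vars
    · rw [← hmatch x hxl]
      exact Term.subst_eq_self fun y hy => by rw [hηA y (hγA x hxl hy)]
    · rw [hγ x hxl, hγ' (τ x) (mt (hlτ x).1 hxl), Term.subst_var, hηB x ⟨hx, hxl⟩]
  have hrename : ∀ u : Term F V, u.vars ⊆ ρ.vars →
      (u.subst fun x => Term.var (τ x)).subst γ' =
        (u.subst γ).subst fun x => Term.var (η x) := by
    intro u hu
    simp only [Term.subst_subst, Term.subst_var]
    exact Term.subst_eq_subst_iff.2 fun x hx => (hγη x (hu hx)).symm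
  have hAB : ∀ u : Term F V, u.vars ⊆ ρ.vars → (u.subst γ).vars ⊆ A ∪ B := by
    intro u hu y hy
    obtain ⟨x, hx, hyx⟩ := Term.mem_vars_subst.1 hy
    by_cases hxl : x ∈ ρ.lhs.vars
    · exact Or.inl (hγA x hxl hyx)
    · rw [hγ x hxl, Term.mem_vars_var] at hyx
      exact Or.inr (hyx ▸ ⟨hu hx, hxl⟩)
  have hrv : ρ.rhs.vars ⊆ ρ.vars := fun x hx => Or.inl (Or.inr hx)
  have hcv : ρ.constr.vars ⊆ ρ.vars := fun x hx => Or.inr hx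
  have hex : ρ.exVars ⊆ B := fun x hx => ⟨hrv hx.1, hx.2⟩
  have hterm₁ : T₁.term.vars ⊆ A ∪ B := fun x hx =>
    (s.target.vars_subset hx).elim (fun h => Or.inl (Or.inl h)) fun h => hAB _ hrv h
  have hterm₂ : T₂.term = T₁.term.subst fun x => Term.var (η x) := by
    have h := s.target.subst fun x => Term.var (η x)
    rw [← hrename _ hrv, ← hr,
      Term.subst_eq_self (t := T.term) fun x hx => by rw [hηA x (Or.inl hx)]] at h
    exact s'.target.unique h
  refine SubsumedBy.of_rename M hηinj hterm₁ ?_ ?_ hterm₂ ?_ ?_ s.bnd s'.bnd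
  · rw [s.cstr, Model.vars_conj]
    exact Set.union_subset (fun x hx => Or.inl (Or.inr hx)) (hAB _ hcv)
  · rw [s.lv]
    exact Set.union_subset (fun x hx => Or.inr (hex hx)) fun x hx => Or.inl (Or.inl (hlvars hx.1))
  · rw [s.cstr, s'.cstr, Model.conj_subst, ← hrename _ hcv, ← hc,
      Term.subst_eq_self (t := T.ec.constr) fun x hx => by rw [hηA x (Or.inr hx)]]
  · rw [s.lv, s'.lv]
    rintro y (⟨hyr, hyl⟩ | ⟨hyT, hyt⟩)
    · rw [hr, Term.vars_rename] at hyr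
      obtain ⟨x, hx, rfl⟩ := hyr
      have hx' : x ∈ ρ.exVars := ⟨hx, mt (hlτ x).2 hyl⟩
      exact ⟨x, Or.inl hx', hηB x (hex hx')⟩
    · rw [hterm₂, Term.vars_rename] at hyt
      obtain ⟨x, hx, hxy⟩ := hyt
      have hyA : y ∈ A := Or.inl (hlvars hyT)
      have : x = y := hηinj (hterm₁ hx) (Or.inl hyA) (hxy.trans (hηA y hyA).symm)
      subst this
      exact ⟨x, Or.inr ⟨hyT, hx⟩, hxy⟩

/-- **Uniqueness of Reducts.** -/
theorem uniqueness_of_reducts {F V D : Type} (M : Model F V D)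
    (T T₁ T₂ : ECTerm F V) (ρ ρ' : Rule F V) (p : Pos)
    (hT : T.WF)
    (hvariants : ∃ ρ₀ : Rule F V, ρ₀.WF ∧ ρ₀.LeftLinear ∧
      ρ.IsVariantOf ρ₀ ∧ ρ'.IsVariantOf ρ₀)
    (hd : Disjoint ρ.vars (T.term.vars ∪ T.ec.constr.vars))
    (hd' : Disjoint ρ'.vars (T.term.vars ∪ T.ec.constr.vars))
    (h1 : MGStepAt M ρ p T T₁) (h2 : MGStepAt M ρ' p T T₂) :
    ECEquiv M T₁ T₂ := by
  obtain ⟨ρ₀, -, -, h, h'⟩ := hvariants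
  exact ⟨SubsumedBy.of_variant_steps M hT (h'.trans h.symm) hd hd' h1 h2,
    SubsumedBy.of_variant_steps M hT (h.trans h'.symm) hd' hd h2 h1⟩

end

end LCTRS
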